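/- For every integer k ≥ 2 of the form k = 2^a k' with a ≥ 0 and k' odd with k' ≥ 3, there exists an index i ≥ 0 divisible by k such that v_i = v_{i+k} and v_i ∈ {0,2}. -/

import Mathlib

/-- The morphism μ : 0 ↦ 012, 1 ↦ 02, 2 ↦ 1. -/
def mu : Fin 3 → List (Fin 3)
  | 0 => [0, 1, 2]
  | 1 => [0, 2]
  | 2 => [1]

/-- Apply μ to a finite word. -/
def muWord (l : List (Fin 3)) : List (Fin 3) := l.flatMap mu

/-- The word vtm = 012021012102012⋯, the fixed point of μ starting with 0,
obtained as the limit of μ^n(0): since μ^m(0) is a prefix of μ^(m+1)(0) and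
its length exceeds n for m = n+1, the n-th letter is read off from μ^(n+1)(0). -/
def vtm (n : ℕ) : Fin 3 := ((muWord^[n + 1]) [0]).getD n 0

/-- The Thue–Morse sequence. -/
def tm (n : ℕ) : Bool :=
  if n = 0 then false else xor (decide (n % 2 = 1)) (tm (n / 2))
termination_by n
decreasing_by omega

theorem tm_zero : tm 0 = false := by rw [tm]; simp

theorem tm_even (n : ℕ) : tm (2 * n) = tm n := by
  rcases Nat.eq_zero_or_pos n with h | h
  · subst h; rfl
  · rw [tm, if_neg (by omega), show 2 * n / 2 = n by omega, show 2 * n % 2 = 0 by omega]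
    simp

theorem tm_odd (n : ℕ) : tm (2 * n + 1) = !tm n := by
  rw [tm, if_neg (by omega), show (2 * n + 1) / 2 = n by omega,
    show (2 * n + 1) % 2 = 1 by omega]
  simp

theorem tm_add (L : ℕ) : ∀ x M : ℕ, x < 2 ^ L → tm (x + 2 ^ L * M) = xor (tm x) (tm M) := by
  induction L with
  | zero => intro x M h; obtain rfl : x = 0 := by simpa using h
            simp [tm_zero]
  | succ L ih =>
    intro x M h
    rw [pow_succ] at h ⊢
    rcases Nat.even_or_odd' x with ⟨y, rfl | rfl⟩
    · rw [show 2 * y + 2 ^ L * 2 * M = 2 * (y + 2 ^ L * M) by ring, tm_even, tm_even,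
        ih _ _ (by omega)]
    · rw [show 2 * y + 1 + 2 ^ L * 2 * M = 2 * (y + 2 ^ L * M) + 1 by ring, tm_odd, tm_odd,
        ih _ _ (by omega)]
      simp

/-- Letter of vtm from two consecutive Thue–Morse letters. -/
def dl (n : ℕ) : Fin 3 :=
  match tm n, tm (n + 1) with
  | false, true => 0
  | true, false => 2
  | _, _ => 1

theorem muWord_range (N : ℕ) :
    muWord ((List.range N).map dl) = (List.range (2 * N + (tm N).toNat)).map dl := by
  induction N with
  | zero => simp [muWord, tm_zero]
  | succ N ih =>
    have e0 := tm_even N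
    have e1 := tm_odd N
    have e2 := tm_even (N + 1)
    have e3 := tm_odd (N + 1)
    rw [show 2 * (N + 1) = 2 * N + 1 + 1 by ring] at e2 e3
    rw [List.range_succ, List.map_append]
    unfold muWord at ih ⊢
    rw [List.flatMap_append, ih]
    rw [show 2 * (N + 1) = 2 * N + 1 + 1 by ring]
    cases h0 : tm N <;> cases h1 : tm (N + 1) <;>
      rw [h0] at e0 e1 <;> rw [h1] at e2 e3 <;>
      simp [List.range_succ, mu, dl, h0, h1, e0, e1, e2, e3]

theorem iter_range (m : ℕ) :
    ∃ L, m < L ∧ muWord^[m] [0] = (List.range L).map dl := by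
  induction m with
  | zero =>
    refine ⟨1, by omega, ?_⟩
    have h1 : tm 1 = true := by simpa [tm_zero] using tm_odd 0
    simp [List.range_succ, dl, tm_zero, h1]
  | succ m ih =>
    obtain ⟨L, hL, h⟩ := ih
    refine ⟨2 * L + (tm L).toNat, by omega, ?_⟩
    rw [Function.iterate_succ_apply', h, muWord_range]

theorem vtm_eq (n : ℕ) : vtm n = dl n := by
  obtain ⟨L, hL, h⟩ := iter_range (n + 1)
  unfold vtm
  rw [h, List.getD_eq_getElem _ _ (by simp; omega)]
  simp

theorem vtm_of (i k : ℕ) (h1 : tm i = tm (i + k)) (h2 : tm (i + 1) = !tm i)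
    (h3 : tm (i + k + 1) = !tm (i + k)) :
    vtm i = vtm (i + k) ∧ (vtm i = 0 ∨ vtm i = 2) := by
  simp only [vtm_eq, dl, h2, h3, ← h1]
  cases tm i <;> simp

theorem exists_tm_ne (y : ℕ) (hy : 0 < y) : ∃ x, tm (x + y) = !tm x := by
  induction y using Nat.strong_induction_on with
  | _ y ih =>
    rcases Nat.even_or_odd' y with ⟨u, rfl | rfl⟩
    · obtain ⟨x, hx⟩ := ih u (by omega) (by omega)
      exact ⟨2 * x, by rw [← mul_add, tm_even, tm_even, hx]⟩
    · exact ⟨2 * u, by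
        rw [show 2 * u + (2 * u + 1) = 2 * (2 * u) + 1 by ring, tm_odd, tm_even]⟩

theorem tm8 (x : ℕ) : tm (8 * x) = tm x ∧ tm (8 * x + 1) = (!tm x) ∧ tm (8 * x + 2) = (!tm x) ∧
    tm (8 * x + 3) = tm x ∧ tm (8 * x + 4) = (!tm x) ∧ tm (8 * x + 5) = tm x ∧
    tm (8 * x + 6) = tm x ∧ tm (8 * x + 7) = !tm x := by
  have h0 := tm_even x
  have h1 := tm_odd x
  have a0 := tm_even (2 * x)
  have a1 := tm_odd (2 * x)
  have a2 := tm_even (2 * x + 1)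
  have a3 := tm_odd (2 * x + 1)
  have b0 := tm_even (2 * (2 * x))
  have b1 := tm_odd (2 * (2 * x))
  have b2 := tm_even (2 * (2 * x) + 1)
  have b3 := tm_odd (2 * (2 * x) + 1)
  have b4 := tm_even (2 * (2 * x + 1))
  have b5 := tm_odd (2 * (2 * x + 1))
  have b6 := tm_even (2 * (2 * x + 1) + 1)
  have b7 := tm_odd (2 * (2 * x + 1) + 1)
  ring_nf at *
  simp_all

theorem exists_low (k : ℕ) (hodd : Odd k) (hk : 3 ≤ k) :
    ∃ n, tm n = tm (n + k) ∧ tm (n + 1) = (!tm n) ∧ tm (n + k + 1) = !tm (n + k) := by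
  obtain ⟨c, hc⟩ := hodd
  have key : ∀ x, tm (8 * x + 3) = tm x ∧ tm (8 * x + 3 + 1) = !tm x := fun x =>
    ⟨(tm8 x).2.2.2.1, (tm8 x).2.2.2.2.1⟩
  have hr : k % 8 = 1 ∨ k % 8 = 3 ∨ k % 8 = 5 ∨ k % 8 = 7 := by omega
  obtain ⟨y, hy⟩ : ∃ y, y = k / 8 := ⟨_, rfl⟩
  rcases hr with hr | hr | hr | hr
  · obtain ⟨x, hx⟩ := exists_tm_ne y (by omega)
    refine ⟨8 * x + 3, ?_⟩
    obtain ⟨k1, k2⟩ := key x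
    have := tm8 (x + y)
    rw [show 8 * x + 3 + k = 8 * (x + y) + 4 by omega]
    simp_all
  · refine ⟨8 * y + 3, ?_⟩
    obtain ⟨k1, k2⟩ := key y
    have := tm8 (2 * y)
    have := tm_even y
    rw [show 8 * y + 3 + k = 8 * (2 * y) + 6 by omega]
    simp_all
  · refine ⟨8 * (y + 1) + 3, ?_⟩
    obtain ⟨k1, k2⟩ := key (y + 1)
    have := tm8 (2 * (y + 1))
    have := tm_even (y + 1)
    rw [show 8 * (y + 1) + 3 + k = 8 * (2 * (y + 1)) by omega]
    simp_all
  · obtain ⟨x, hx⟩ := exists_tm_ne (y + 1) (by omega)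
    refine ⟨8 * x + 3, ?_⟩
    obtain ⟨k1, k2⟩ := key x
    have := tm8 (x + (y + 1))
    rw [show 8 * x + 3 + k = 8 * (x + (y + 1)) + 2 by omega]
    simp_all

theorem tm_pow (a n : ℕ) : tm (2 ^ a * n) = tm n := by
  have := tm_add a 0 n (by positivity)
  simpa [tm_zero] using this

/-- For every k ≥ 2 of the form k = 2^a k' with k' odd, k' ≥ 3, vtm has an
occurrence of a length-(k+1) factor of the form 0u0 or 2u2 at a position
divisible by k. -/
theorem vtm_even_occurrence (k a k' : ℕ) (hk : 2 ≤ k) (hfact : k = 2 ^ a * k')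
    (hodd : Odd k') (hk' : 3 ≤ k') :
    ∃ i : ℕ, k ∣ i ∧ vtm i = vtm (i + k) ∧ (vtm i = 0 ∨ vtm i = 2) := by
  rcases Nat.even_or_odd' k with ⟨c, hc | hc⟩
  · refine ⟨k, dvd_rfl, vtm_of k k ?_ ?_ ?_⟩
    · rw [← two_mul, tm_even]
    · rw [hc, tm_odd, tm_even]
    · rw [← two_mul, tm_odd, tm_even]
  · have hk3 : 3 ≤ k := by
      have : 1 ≤ 2 ^ a := Nat.one_le_two_pow
      nlinarith
    have hko : Odd k := ⟨c, hc⟩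
    obtain ⟨n, h1, h2, h3⟩ := exists_low k hko hk3
    have hL : n + k + 1 < 2 ^ (n + k + 1) := Nat.lt_two_pow_self

    obtain ⟨L, hLe⟩ : ∃ L, L = n + k + 1 := ⟨_, rfl⟩
    rw [← hLe] at hL
    have hcop : Nat.Coprime (2 ^ L) k := Nat.Coprime.pow_left _ (Nat.coprime_two_left.mpr hko)
    obtain ⟨i, hi1, hi2⟩ := Nat.chineseRemainder hcop n 0
    have hin : i % 2 ^ L = n := by
      rw [hi1, Nat.mod_eq_of_lt (by omega)]
    have hi : i = n + 2 ^ L * (i / 2 ^ L) := by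
      have := Nat.mod_add_div i (2 ^ L)
      omega
    have hdiv : k ∣ i := (Nat.modEq_zero_iff_dvd).mp hi2
    generalize i / 2 ^ L = M at hi
    have g0 := tm_add L n M (by omega)
    have g1 := tm_add L (n + 1) M (by omega)
    have g2 := tm_add L (n + k) M (by omega)
    have g3 := tm_add L (n + k + 1) M (by omega)
    refine ⟨i, hdiv, vtm_of i k ?_ ?_ ?_⟩
    · rw [hi, show n + 2 ^ L * M + k = n + k + 2 ^ L * M by ring, g0, g2, h1]
    · rw [hi, show n + 2 ^ L * M + 1 = n + 1 + 2 ^ L * M by ring, g0, g1, h2]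
      simp
    · rw [hi, show n + 2 ^ L * M + k + 1 = n + k + 1 + 2 ^ L * M by ring,
        show n + 2 ^ L * M + k = n + k + 2 ^ L * M by ring, g2, g3, h3]
      simp
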